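/- Fix θ_0 ∈ 𝕊^n, and for r > 0 let P_r = (sinh r · θ_0, cosh r) ∈ ℍ^{n+1} and let T(r) = ∩ {B̄_e(s) : e ∈ 𝕊^n, s ∈ ℝ, O ∈ H_e(s) and P_r ∈ H_e(s)} be the intersection of all closed horo-balls whose boundary horosphere passes through both O and P_r. Then V(T(r)) → +∞ as r → ∞; in particular, for every M > 0 there exists C > 0 such that every h-convex body K containing two points at geodesic distance at least C satisfies V(K) > M. -/

import Mathlib

noncomputable section

open Real MeasureTheory Filter Topology Set
open scoped ENNReal symmDiff

namespace Horo

/-- The Lorentzian inner product on ℝ^{n+2}: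
`X·Y = Σ_{i=1}^{n+1} x_i y_i − x_{n+2} y_{n+2}`. -/
def lprod (n : ℕ) (X Y : Fin (n + 2) → ℝ) : ℝ :=
  (∑ i : Fin (n + 1), X i.castSucc * Y i.castSucc) - X (Fin.last (n + 1)) * Y (Fin.last (n + 1))

/-- The hyperboloid model ℍ^{n+1} of hyperbolic space. -/
def Hyp (n : ℕ) : Set (Fin (n + 2) → ℝ) :=
  {X | lprod n X X = -1 ∧ 0 < X (Fin.last (n + 1))}

/-- The origin O = (0,…,0,1) of hyperbolic space. -/
def origin (n : ℕ) : Fin (n + 2) → ℝ := Fin.snoc (fun _ => 0) 1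

/-- The unit sphere 𝕊^n ⊂ ℝ^{n+1}. -/
def sph (n : ℕ) : Set (Fin (n + 1) → ℝ) := {e | ∑ i, e i ^ 2 = 1}

/-- The null vector (e,1) ∈ ℝ^{n+2} associated with e ∈ 𝕊^n. -/
def dir {n : ℕ} (e : Fin (n + 1) → ℝ) : Fin (n + 2) → ℝ := Fin.snoc e 1

/-- The geodesic distance d(X,Y) = arcosh(−X·Y) on the hyperboloid. -/
def dH (n : ℕ) (X Y : Fin (n + 2) → ℝ) : ℝ :=
  Real.log (-(lprod n X Y) + Real.sqrt ((lprod n X Y) ^ 2 - 1))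

/-- The horosphere H_e(s) = {X ∈ ℍ^{n+1} : X·(e,1) = −e^s}. -/
def horoSphere (n : ℕ) (e : Fin (n + 1) → ℝ) (s : ℝ) : Set (Fin (n + 2) → ℝ) :=
  {X ∈ Hyp n | lprod n X (dir e) = -Real.exp s}

/-- The open horo-ball B_e(s) = {X ∈ ℍ^{n+1} : 0 > X·(e,1) > −e^s}. -/
def horoBall (n : ℕ) (e : Fin (n + 1) → ℝ) (s : ℝ) : Set (Fin (n + 2) → ℝ) :=
  {X ∈ Hyp n | 0 > lprod n X (dir e) ∧ lprod n X (dir e) > -Real.exp s}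

/-- The closed horo-ball B̄_e(s) = {X ∈ ℍ^{n+1} : 0 > X·(e,1) ≥ −e^s}. -/
def horoBallCl (n : ℕ) (e : Fin (n + 1) → ℝ) (s : ℝ) : Set (Fin (n + 2) → ℝ) :=
  {X ∈ Hyp n | 0 > lprod n X (dir e) ∧ lprod n X (dir e) ≥ -Real.exp s}

/-- A set Ω ⊂ ℍ^{n+1} is horospherically convex (h-convex) if it is closed and every
relative boundary point of Ω admits a supporting horo-ball. -/
def IsHConvex (n : ℕ) (Ω : Set (Fin (n + 2) → ℝ)) : Prop :=
  Ω ⊆ Hyp n ∧ IsClosed Ω ∧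
    ∀ X ∈ Ω ∩ closure (Hyp n \ Ω),
      ∃ e ∈ sph n, ∃ s : ℝ, Ω ⊆ horoBallCl n e s ∧ X ∈ horoSphere n e s

/-- The interior of a subset of the hyperboloid, relative to the hyperboloid. -/
def relInt (n : ℕ) (K : Set (Fin (n + 2) → ℝ)) : Set (Fin (n + 2) → ℝ) :=
  {X ∈ Hyp n | ∃ ε > 0, ∀ Y ∈ Hyp n, dH n X Y < ε → Y ∈ K}

/-- A h-convex body: a compact h-convex set with nonempty (relative) interior. -/
def IsHConvexBody (n : ℕ) (K : Set (Fin (n + 2) → ℝ)) : Prop :=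
  IsHConvex n K ∧ IsCompact K ∧ (relInt n K).Nonempty

/-- A h-convex polytope: a h-convex body which is a finite intersection of closed
horo-balls. -/
def IsHPolytope (n : ℕ) (P : Set (Fin (n + 2) → ℝ)) : Prop :=
  IsHConvexBody n P ∧ ∃ m : ℕ, 2 ≤ m ∧ ∃ (e : Fin m → (Fin (n + 1) → ℝ)) (u : Fin m → ℝ),
    (∀ i, e i ∈ sph n) ∧ P = ⋂ i, horoBallCl n (e i) (u i)

/-- The horospherical support function u(K,e) = sup{log(−X·(e,1)) : X ∈ K}. -/
def suppFn (n : ℕ) (K : Set (Fin (n + 2) → ℝ)) (e : Fin (n + 1) → ℝ) : ℝ :=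
  sSup ((fun X => Real.log (-(lprod n X (dir e)))) '' K)

/-- The outer parallel set K^ε = {X ∈ ℍ^{n+1} : d(K,X) ≤ ε}. -/
def outPar (n : ℕ) (K : Set (Fin (n + 2) → ℝ)) (ε : ℝ) : Set (Fin (n + 2) → ℝ) :=
  {X ∈ Hyp n | ∃ Y ∈ K, dH n Y X ≤ ε}

/-- The Hausdorff distance d_H(K,L) = inf{ε ≥ 0 : K ⊆ L^ε and L ⊆ K^ε}. -/
def dHaus (n : ℕ) (K L : Set (Fin (n + 2) → ℝ)) : ℝ :=
  sInf {ε : ℝ | 0 ≤ ε ∧ K ⊆ outPar n L ε ∧ L ⊆ outPar n K ε}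

/-- The point (sinh r · θ, cosh r) ∈ ℍ^{n+1} at distance r from O in direction θ. -/
def rpt (n : ℕ) (θ : Fin (n + 1) → ℝ) (r : ℝ) : Fin (n + 2) → ℝ :=
  Fin.snoc (fun i => Real.sinh r * θ i) (Real.cosh r)

/-- The radial function ρ(K,θ) = max{λ ≥ 0 : (sinh λ · θ, cosh λ) ∈ K}. -/
def radFn (n : ℕ) (K : Set (Fin (n + 2) → ℝ)) (θ : Fin (n + 1) → ℝ) : ℝ :=
  sSup {r : ℝ | 0 ≤ r ∧ rpt n θ r ∈ K}

/-- R(K) = max_θ ρ(K,θ). -/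
def Rmax (n : ℕ) (K : Set (Fin (n + 2) → ℝ)) : ℝ := sSup (radFn n K '' sph n)

/-- r(K) = min_θ ρ(K,θ). -/
def rmin (n : ℕ) (K : Set (Fin (n + 2) → ℝ)) : ℝ := sInf (radFn n K '' sph n)

/-- The point reflection (x_1,…,x_{n+1},x_{n+2}) ↦ (−x_1,…,−x_{n+1},x_{n+2}) about O. -/
def symMap (n : ℕ) (X : Fin (n + 2) → ℝ) : Fin (n + 2) → ℝ :=
  fun i => if i = Fin.last (n + 1) then X i else -X i

/-- The hyperbolic (Riemannian) volume of a subset of the hyperboloid, computed via the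
graph parametrization x ↦ (x, √(1+|x|²)), whose volume density is 1/√(1+|x|²). -/
def hypVol (n : ℕ) (K : Set (Fin (n + 2) → ℝ)) : ℝ :=
  ∫ x : Fin (n + 1) → ℝ,
    Set.indicator {y : Fin (n + 1) → ℝ | Fin.snoc y (Real.sqrt (1 + ∑ i, y i ^ 2)) ∈ K}
      (fun y => 1 / Real.sqrt (1 + ∑ i, y i ^ 2)) x

/-- The distance from a point X to a set P. -/
def distTo (n : ℕ) (P : Set (Fin (n + 2) → ℝ)) (X : Fin (n + 2) → ℝ) : ℝ :=
  sInf ((fun Y => dH n Y X) '' P)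

/-- The facet F(P,e) = P ∩ H_e(u(P,e)). -/
def facet (n : ℕ) (P : Set (Fin (n + 2) → ℝ)) (e : Fin (n + 1) → ℝ) :
    Set (Fin (n + 2) → ℝ) :=
  P ∩ horoSphere n e (suppFn n P e)

/-- The relative interior of the facet F(P,e) inside the horosphere H_e(u(P,e)). -/
def facetRelInt (n : ℕ) (P : Set (Fin (n + 2) → ℝ)) (e : Fin (n + 1) → ℝ) :
    Set (Fin (n + 2) → ℝ) :=
  {Y ∈ facet n P e | ∃ δ > 0, ∀ Z ∈ horoSphere n e (suppFn n P e),
    dH n Y Z < δ → Z ∈ facet n P e}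

/-- The collar 𝒫_t(P, F̊(P,e)): points at positive distance ≤ t from P whose nearest
point in P lies in the relative interior of the facet F(P,e). -/
def collar (n : ℕ) (P : Set (Fin (n + 2) → ℝ)) (e : Fin (n + 1) → ℝ) (t : ℝ) :
    Set (Fin (n + 2) → ℝ) :=
  {X ∈ Hyp n | 0 < distTo n P X ∧ distTo n P X ≤ t ∧
    ∃ Y ∈ facetRelInt n P e, ∀ Z ∈ P, dH n Y X ≤ dH n Z X}

/-- The diameter of a set with respect to a distance function, in ℝ≥0∞. -/
def ediamWith {α : Type*} (d : α → α → ℝ) (U : Set α) : ℝ≥0∞ :=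
  ⨆ (x ∈ U) (y ∈ U), ENNReal.ofReal (d x y)

/-- The (unnormalized) s-dimensional Hausdorff measure associated with a distance
function d, via the Carathéodory construction. -/
def hMeasWith {α : Type*} (d : α → α → ℝ) (s : ℕ) (A : Set α) : ℝ≥0∞ :=
  ⨆ (δ : ℝ) (_ : 0 < δ),
    ⨅ (U : ℕ → Set α) (_ : A ⊆ ⋃ i, U i) (_ : ∀ i, ediamWith d (U i) ≤ ENNReal.ofReal δ),
      ∑' i, ediamWith d (U i) ^ s

/-- ω_n, the volume of the unit ball in ℝ^n. -/
def unitBallVol (n : ℕ) : ℝ :=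
  (volume (Metric.ball (0 : EuclideanSpace ℝ (Fin n)) 1)).toReal

/-- S(P,e): the n-dimensional area of the facet F(P,e), i.e. the normalized
n-dimensional Hausdorff measure of F(P,e) with respect to the hyperbolic distance. -/
def areaFacet (n : ℕ) (P : Set (Fin (n + 2) → ℝ)) (e : Fin (n + 1) → ℝ) : ℝ :=
  (ENNReal.ofReal (unitBallVol n / 2 ^ n) * hMeasWith (dH n) n (facet n P e)).toReal


variable {n : ℕ}

lemma lprod_eq (X Y : Fin (n + 2) → ℝ) :
    lprod n X Y = Fin.init X ⬝ᵥ Fin.init Y - X (Fin.last (n + 1)) * Y (Fin.last (n + 1)) := rfl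

lemma lprod_snoc_left (x : Fin (n + 1) → ℝ) (a : ℝ) (Y : Fin (n + 2) → ℝ) :
    lprod n (Fin.snoc x a) Y = x ⬝ᵥ Fin.init Y - a * Y (Fin.last (n + 1)) := by
  simp [lprod_eq]

lemma lprod_comm (X Y : Fin (n + 2) → ℝ) : lprod n X Y = lprod n Y X := by
  rw [lprod_eq, lprod_eq, dotProduct_comm, mul_comm (X _)]

lemma lprod_add_left (X X' Y : Fin (n + 2) → ℝ) :
    lprod n (X + X') Y = lprod n X Y + lprod n X' Y := by
  simp only [lprod, Pi.add_apply, add_mul, Finset.sum_add_distrib]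
  ring

lemma lprod_smul_left (c : ℝ) (X Y : Fin (n + 2) → ℝ) :
    lprod n (c • X) Y = c * lprod n X Y := by
  simp only [lprod, Pi.smul_apply, smul_eq_mul, mul_assoc, mul_sub, Finset.mul_sum]

lemma lprod_add_right (X Y Y' : Fin (n + 2) → ℝ) :
    lprod n X (Y + Y') = lprod n X Y + lprod n X Y' := by
  rw [lprod_comm, lprod_add_left, lprod_comm Y, lprod_comm Y']

lemma lprod_smul_right (c : ℝ) (X Y : Fin (n + 2) → ℝ) :
    lprod n X (c • Y) = c * lprod n X Y := by
  rw [lprod_comm, lprod_smul_left, lprod_comm]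

lemma dotProduct_sq_le {m : ℕ} (x y : Fin m → ℝ) :
    (x ⬝ᵥ y) ^ 2 ≤ (x ⬝ᵥ x) * (y ⬝ᵥ y) := by
  have := Finset.sum_mul_sq_le_sq_mul_sq Finset.univ x y
  simpa only [dotProduct, sq] using this

lemma dotProduct_self_nonneg {m : ℕ} (x : Fin m → ℝ) : 0 ≤ x ⬝ᵥ x :=
  Finset.sum_nonneg fun i _ => mul_self_nonneg (x i)

lemma sum_sq_eq_dotProduct {m : ℕ} (x : Fin m → ℝ) : ∑ i, x i ^ 2 = x ⬝ᵥ x := by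
  simp only [dotProduct, sq]

/-- A point of the hyperboloid and a future causal vector have negative Lorentz product. -/
lemma lprod_neg {X Y : Fin (n + 2) → ℝ} (hX : X ∈ Hyp n) (hY : 0 < Y (Fin.last (n + 1)))
    (hYY : lprod n Y Y ≤ 0) : lprod n X Y < 0 := by
  obtain ⟨h1, h2⟩ := hX
  rw [lprod_eq] at *
  have h3 := dotProduct_sq_le (Fin.init X) (Fin.init Y)
  have h4 := dotProduct_self_nonneg (Fin.init X)
  have h5 : (Fin.init X ⬝ᵥ Fin.init Y) ^ 2 <
      (X (Fin.last (n + 1)) * Y (Fin.last (n + 1))) ^ 2 := by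
    nlinarith [mul_le_mul_of_nonneg_left (sub_nonpos.1 hYY) h4, mul_pos hY hY]
  have := abs_lt_of_sq_lt_sq h5 (by positivity)
  linarith [(abs_lt.1 this).2]

/-- The reverse Cauchy–Schwarz inequality on the hyperboloid. -/
lemma lprod_le_neg_one {X Y : Fin (n + 2) → ℝ} (hX : X ∈ Hyp n) (hY : Y ∈ Hyp n) :
    lprod n X Y ≤ -1 := by
  obtain ⟨h1, h2⟩ := hX
  obtain ⟨h1', h2'⟩ := hY
  rw [lprod_eq] at *
  have h3 := dotProduct_sq_le (Fin.init X) (Fin.init Y)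
  have h6 := dotProduct_self_nonneg (Fin.init X - Fin.init Y)
  rw [sub_dotProduct, dotProduct_sub, dotProduct_sub,
    dotProduct_comm (Fin.init Y) (Fin.init X)] at h6
  have h5 : (Fin.init X ⬝ᵥ Fin.init Y + 1) ^ 2 ≤
      (X (Fin.last (n + 1)) * Y (Fin.last (n + 1))) ^ 2 := by
    have e1 : X (Fin.last (n + 1)) ^ 2 = 1 + Fin.init X ⬝ᵥ Fin.init X := by linarith
    have e2 : Y (Fin.last (n + 1)) ^ 2 = 1 + Fin.init Y ⬝ᵥ Fin.init Y := by linarith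
    rw [mul_pow, e1, e2]
    nlinarith
  have := abs_le_of_sq_le_sq h5 (by positivity)
  linarith [le_abs_self (Fin.init X ⬝ᵥ Fin.init Y + 1)]

lemma mem_Hyp_of_lprod_neg {X Y : Fin (n + 2) → ℝ} (hX : X ∈ Hyp n)
    (hYY : lprod n Y Y = -1) (hXY : lprod n X Y < 0) : Y ∈ Hyp n := by
  refine ⟨hYY, ?_⟩
  by_contra! h
  rcases h.lt_or_eq with h | h
  · have := lprod_neg (Y := (-1 : ℝ) • Y) hX (by simpa using h)
      (by rw [lprod_smul_left, lprod_smul_right]; linarith)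
    rw [lprod_smul_right] at this
    linarith
  · rw [lprod_eq, h] at hYY
    linarith [dotProduct_self_nonneg (Fin.init Y)]

/-- The point reflection at a point `Z` preserves the hyperboloid. -/
lemma reflect_mem_Hyp {W Z : Fin (n + 2) → ℝ} (hW : W ∈ Hyp n) (hZ : Z ∈ Hyp n) :
    (-1 : ℝ) • W + (-2 * lprod n W Z) • Z ∈ Hyp n := by
  have hZZ := hZ.1
  have hWW := hW.1
  have h := lprod_le_neg_one hW hZ
  apply mem_Hyp_of_lprod_neg hZ
  · simp only [lprod_add_left, lprod_add_right, lprod_smul_left, lprod_smul_right,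
      lprod_comm Z W, hZZ, hWW]
    ring
  · simp only [lprod_add_right, lprod_smul_right, lprod_comm Z W, hZZ]
    linarith

lemma neg_lprod_lt {W Z N : Fin (n + 2) → ℝ} (hW : W ∈ Hyp n) (hZ : Z ∈ Hyp n)
    (hN : 0 < N (Fin.last (n + 1))) (hNN : lprod n N N ≤ 0) :
    -lprod n W N < 2 * lprod n W Z * lprod n Z N := by
  have := lprod_neg (reflect_mem_Hyp hW hZ) hN hNN
  simp only [lprod_add_left, lprod_smul_left] at this
  linarith

lemma last_lt {W Z : Fin (n + 2) → ℝ} (hW : W ∈ Hyp n) (hZ : Z ∈ Hyp n) :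
    W (Fin.last (n + 1)) < 2 * -lprod n W Z * Z (Fin.last (n + 1)) := by
  have := (reflect_mem_Hyp hW hZ).2
  simp only [Pi.add_apply, Pi.smul_apply, smul_eq_mul] at this
  linarith

lemma dir_last (e : Fin (n + 1) → ℝ) : dir e (Fin.last (n + 1)) = 1 := by
  simp [dir]

lemma lprod_dir_dir {e : Fin (n + 1) → ℝ} (he : e ∈ sph n) : lprod n (dir e) (dir e) = 0 := by
  have : e ⬝ᵥ e = 1 := by rw [← sum_sq_eq_dotProduct]; exact he
  simp [dir, lprod_eq, this]

lemma lprod_dir_neg {X : Fin (n + 2) → ℝ} {e : Fin (n + 1) → ℝ} (hX : X ∈ Hyp n)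
    (he : e ∈ sph n) : lprod n X (dir e) < 0 :=
  lprod_neg hX (by simp [dir_last]) (lprod_dir_dir he).le

lemma mem_horoBallCl_iff {X : Fin (n + 2) → ℝ} {e : Fin (n + 1) → ℝ} {s : ℝ}
    (hX : X ∈ Hyp n) (he : e ∈ sph n) :
    X ∈ horoBallCl n e s ↔ -Real.exp s ≤ lprod n X (dir e) :=
  ⟨fun h => h.2.2, fun h => ⟨hX, lprod_dir_neg hX he, h⟩⟩

/-- The Lorentz norm of `X + Y`. -/
def pairNorm (n : ℕ) (X Y : Fin (n + 2) → ℝ) : ℝ := √(2 + 2 * -lprod n X Y)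

/-- The hyperbolic midpoint of `X` and `Y`. -/
def midpt (n : ℕ) (X Y : Fin (n + 2) → ℝ) : Fin (n + 2) → ℝ := (pairNorm n X Y)⁻¹ • (X + Y)

lemma pairNorm_pos {X Y : Fin (n + 2) → ℝ} (hX : X ∈ Hyp n) (hY : Y ∈ Hyp n) :
    0 < pairNorm n X Y :=
  Real.sqrt_pos.2 (by linarith [lprod_le_neg_one hX hY])

lemma midpt_mem_Hyp {X Y : Fin (n + 2) → ℝ} (hX : X ∈ Hyp n) (hY : Y ∈ Hyp n) :
    midpt n X Y ∈ Hyp n := by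
  have hl := pairNorm_pos hX hY
  have hsq : pairNorm n X Y ^ 2 = 2 + 2 * -lprod n X Y :=
    Real.sq_sqrt (by linarith [lprod_le_neg_one hX hY])
  constructor
  · have : lprod n (X + Y) (X + Y) = -pairNorm n X Y ^ 2 := by
      simp only [lprod_add_left, lprod_add_right, lprod_comm Y X, hX.1, hY.1, hsq]
      ring
    rw [midpt, lprod_smul_left, lprod_smul_right, this]
    field_simp
  · have h1 := hX.2
    have h2 := hY.2
    simp only [midpt, Pi.smul_apply, Pi.add_apply, smul_eq_mul]
    positivity

/-- A horo-ball containing `X` and `Y` contains a large ball about their midpoint. -/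
lemma lprod_dir_gt_of_near_midpt {X Y W : Fin (n + 2) → ℝ} {e : Fin (n + 1) → ℝ} {s : ℝ}
    (he : e ∈ sph n) (hX : X ∈ horoBallCl n e s) (hY : Y ∈ horoBallCl n e s)
    (hW : W ∈ Hyp n) (hWZ : -lprod n W (midpt n X Y) ≤ pairNorm n X Y / 4) :
    -Real.exp s < lprod n W (dir e) := by
  have hl := pairNorm_pos hX.1 hY.1
  have hZ := midpt_mem_Hyp hX.1 hY.1
  have h1 := neg_lprod_lt hW hZ (N := dir e) (by simp [dir_last]) (lprod_dir_dir he).le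
  have h2 : pairNorm n X Y * -lprod n (midpt n X Y) (dir e) ≤ 2 * Real.exp s := by
    have h3 : pairNorm n X Y * lprod n (midpt n X Y) (dir e) =
        lprod n X (dir e) + lprod n Y (dir e) := by
      rw [midpt, lprod_smul_left, lprod_add_left]
      field_simp
    linarith [hX.2.2, hY.2.2]
  have h4 := mul_le_mul_of_nonneg_right hWZ (neg_nonneg.2 (lprod_dir_neg hZ he).le)
  linarith

/-- The point of the hyperboloid above `x`. -/
def lift (x : Fin (n + 1) → ℝ) : Fin (n + 2) → ℝ := Fin.snoc x (√(1 + ∑ i, x i ^ 2))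

lemma continuous_lift : Continuous (lift (n := n)) := by
  unfold lift
  exact Continuous.finSnoc continuous_id (by fun_prop)

lemma lift_last (x : Fin (n + 1) → ℝ) : lift x (Fin.last (n + 1)) = √(1 + x ⬝ᵥ x) := by
  simp [lift, sum_sq_eq_dotProduct]

lemma init_lift (x : Fin (n + 1) → ℝ) : Fin.init (lift x) = x := by
  simp [lift]

lemma lift_mem_Hyp (x : Fin (n + 1) → ℝ) : lift x ∈ Hyp n := by
  have := dotProduct_self_nonneg x
  constructor
  · rw [lprod_eq, lift_last, init_lift, Real.mul_self_sqrt (by positivity)]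
    ring
  · rw [lift_last]
    positivity

lemma lift_init {X : Fin (n + 2) → ℝ} (hX : X ∈ Hyp n) : lift (Fin.init X) = X := by
  have h := hX.1
  rw [lprod_eq] at h
  have : X (Fin.last (n + 1)) = √(1 + Fin.init X ⬝ᵥ Fin.init X) := by
    rw [eq_comm, Real.sqrt_eq_iff_mul_self_eq (by linarith [dotProduct_self_nonneg (Fin.init X)])
      hX.2.le]
    linarith
  rw [lift, sum_sq_eq_dotProduct, ← this, Fin.snoc_init_self]

lemma continuous_lprod_left (Y : Fin (n + 2) → ℝ) : Continuous fun X => lprod n X Y := by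
  unfold lprod
  fun_prop

lemma dH_self {X : Fin (n + 2) → ℝ} (hX : X ∈ Hyp n) : dH n X X = 0 := by
  simp [dH, hX.1]

lemma continuousAt_dH {X : Fin (n + 2) → ℝ} (hX : X ∈ Hyp n) : ContinuousAt (dH n X) X := by
  have h : Continuous fun Y => lprod n X Y := by
    simpa only [lprod_comm X] using continuous_lprod_left X
  unfold dH
  refine ContinuousAt.log (by fun_prop) ?_
  simp [hX.1]

/-- In the graph chart, the function defining a horo-ball is concave. -/
lemma lprod_dir_segment {P W : Fin (n + 2) → ℝ} (hP : P ∈ Hyp n) (hW : W ∈ Hyp n)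
    (e : Fin (n + 1) → ℝ) {t : ℝ} (h0 : 0 ≤ t) (h1 : t ≤ 1) :
    (1 - t) * lprod n P (dir e) + t * lprod n W (dir e) ≤
      lprod n (lift ((1 - t) • Fin.init P + t • Fin.init W)) (dir e) := by
  have hPW := lprod_le_neg_one hP hW
  have hPP := hP.1
  have hWW := hW.1
  have hP0 := hP.2
  have hW0 := hW.2
  set x := (1 - t) • Fin.init P + t • Fin.init W with hx
  have key : √(1 + x ⬝ᵥ x) ≤ (1 - t) * P (Fin.last (n + 1)) + t * W (Fin.last (n + 1)) := by
    apply Real.sqrt_le_iff.2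
    have h1' : 0 ≤ 1 - t := by linarith
    refine ⟨by positivity, ?_⟩
    rw [lprod_eq] at hPW hPP hWW
    have : x ⬝ᵥ x = (1 - t) ^ 2 * (Fin.init P ⬝ᵥ Fin.init P) +
        2 * (t * (1 - t)) * (Fin.init P ⬝ᵥ Fin.init W) +
        t ^ 2 * (Fin.init W ⬝ᵥ Fin.init W) := by
      simp only [hx, add_dotProduct, dotProduct_add, smul_dotProduct, dotProduct_smul,
        smul_eq_mul, dotProduct_comm (Fin.init W) (Fin.init P)]
      ring
    rw [this]
    have h2 := mul_le_mul_of_nonneg_left hPW (mul_nonneg h0 h1')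
    nlinarith
  simp only [lprod_eq, dir_last, init_lift, lift_last, mul_one]
  have : x ⬝ᵥ Fin.init (dir e) = (1 - t) * (Fin.init P ⬝ᵥ Fin.init (dir e)) +
      t * (Fin.init W ⬝ᵥ Fin.init (dir e)) := by
    simp only [hx, add_dotProduct, smul_dotProduct, smul_eq_mul]
  rw [this]
  linarith

/-- A h-convex body contains every point lying strictly inside all closed horo-balls that
contain the body. -/
lemma mem_of_forall_horoBallCl {K : Set (Fin (n + 2) → ℝ)} (hK : IsHConvexBody n K)
    {W : Fin (n + 2) → ℝ} (hW : W ∈ Hyp n)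
    (h : ∀ e ∈ sph n, ∀ s : ℝ, K ⊆ horoBallCl n e s → -Real.exp s < lprod n W (dir e)) :
    W ∈ K := by
  obtain ⟨⟨hKH, hKc, hbd⟩, -, P, hP, ε, hε, hPK⟩ := hK
  have hPmem : P ∈ K := hPK P hP (by rwa [dH_self hP])
  let γ : ℝ → Fin (n + 2) → ℝ := fun t => lift ((1 - t) • Fin.init P + t • Fin.init W)
  have hγ : Continuous γ := continuous_lift.comp (by fun_prop)
  have hγ0 : γ 0 = P := by simp [γ, lift_init hP]
  have hγ1 : γ 1 = W := by simp [γ, lift_init hW]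
  have hTc : IsCompact (Icc (0 : ℝ) 1 ∩ γ ⁻¹' K) :=
    isCompact_Icc.inter_right (hKc.preimage hγ)
  obtain ⟨t, ⟨⟨ht0, ht1⟩, htK⟩, htmax⟩ :=
    hTc.exists_isGreatest ⟨0, by simp, by simpa [hγ0] using hPmem⟩
  rcases ht1.lt_or_eq with ht1 | rfl
  swap
  · rwa [mem_preimage, hγ1] at htK
  exfalso
  have hout : ∀ᶠ u in 𝓝[>] t, γ u ∈ Hyp n \ K := by
    filter_upwards [Ioc_mem_nhdsGT ht1] with u hu
    refine ⟨lift_mem_Hyp _, fun hu' => ?_⟩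
    exact absurd (htmax ⟨⟨ht0.trans hu.1.le, hu.2⟩, hu'⟩) (not_le.2 hu.1)
  have hlim : Tendsto γ (𝓝[>] t) (𝓝 (γ t)) := hγ.continuousAt.tendsto.mono_left inf_le_left
  rcases ht0.eq_or_lt with rfl | ht0
  · rw [hγ0] at hlim
    have h1 := (continuousAt_dH hP).tendsto.comp hlim
    rw [dH_self hP] at h1
    obtain ⟨u, hu1, hu2⟩ := (hout.and (h1.eventually_lt_const hε)).exists
    exact hu1.2 (hPK _ hu1.1 hu2)
  · obtain ⟨e, he, s, hsub, hmem⟩ :=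
      hbd (γ t) ⟨htK, mem_closure_of_tendsto hlim hout⟩
    have h1 := lprod_dir_segment hP hW e ht0.le ht1.le
    have h2 := (hsub hPmem).2.2
    have h3 := h e he s hsub
    have h4 : lprod n (γ t) (dir e) = -Real.exp s := hmem.2
    change _ ≤ lprod n (γ t) (dir e) at h1
    nlinarith

lemma ball_midpt_subset {K : Set (Fin (n + 2) → ℝ)} (hK : IsHConvexBody n K)
    {X Y W : Fin (n + 2) → ℝ} (hX : X ∈ K) (hY : Y ∈ K) (hW : W ∈ Hyp n)
    (hWZ : -lprod n W (midpt n X Y) ≤ pairNorm n X Y / 4) : W ∈ K :=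
  mem_of_forall_horoBallCl hK hW fun _ he _ hsub =>
    lprod_dir_gt_of_near_midpt he (hsub hX) (hsub hY) hW hWZ

/-- The spatial part of the Lorentz boost taking the origin to `Z`. -/
def boost (n : ℕ) (Z : Fin (n + 2) → ℝ) : (Fin (n + 1) → ℝ) →ₗ[ℝ] (Fin (n + 1) → ℝ) :=
  Matrix.toLin' (1 + Matrix.replicateCol Unit ((1 + Z (Fin.last (n + 1)))⁻¹ • Fin.init Z) *
    Matrix.replicateRow Unit (Fin.init Z))

lemma boost_apply (Z : Fin (n + 2) → ℝ) (u : Fin (n + 1) → ℝ) :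
    boost n Z u = u + ((u ⬝ᵥ Fin.init Z) / (1 + Z (Fin.last (n + 1)))) • Fin.init Z := by
  ext i
  simp only [boost, Matrix.toLin'_apply, Matrix.add_mulVec, Matrix.one_mulVec, Pi.add_apply,
    ← Matrix.mulVec_mulVec, Pi.smul_apply, smul_eq_mul]
  simp only [Matrix.mulVec, dotProduct, Matrix.replicateCol_apply, Matrix.replicateRow_apply,
    Finset.univ_unique, Finset.sum_singleton, Pi.smul_apply, smul_eq_mul]
  simp only [mul_comm (Fin.init Z _) (u _)]
  ring

lemma det_boost {Z : Fin (n + 2) → ℝ} (hZ : Z ∈ Hyp n) :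
    LinearMap.det (boost n Z) = Z (Fin.last (n + 1)) := by
  have h := hZ.1
  have h0 := hZ.2
  rw [lprod_eq] at h
  rw [boost, LinearMap.det_toLin', Matrix.det_one_add_replicateCol_mul_replicateRow,
    dotProduct_smul, smul_eq_mul]
  have : Fin.init Z ⬝ᵥ Fin.init Z = Z (Fin.last (n + 1)) ^ 2 - 1 := by linarith
  rw [this]
  field_simp
  ring

/-- The boosted Euclidean ball lies in the projection of the hyperbolic ball centred at `Z`
whose radius has hyperbolic cosine `R`. -/
lemma neg_lprod_lift_boost_le {Z : Fin (n + 2) → ℝ} (hZ : Z ∈ Hyp n) {R : ℝ} (hR : 1 ≤ R)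
    {u : Fin (n + 1) → ℝ}
    (hu : (u - (R / Z (Fin.last (n + 1))) • Fin.init Z) ⬝ᵥ
      (u - (R / Z (Fin.last (n + 1))) • Fin.init Z) ≤ R ^ 2 - 1) :
    -lprod n (lift (boost n Z u)) Z ≤ R := by
  have h := hZ.1
  have h0 := hZ.2
  rw [lprod_eq] at h
  have hz : Fin.init Z ⬝ᵥ Fin.init Z = Z (Fin.last (n + 1)) ^ 2 - 1 := by linarith
  rw [lprod_eq, init_lift, lift_last, boost_apply]
  simp only [sub_dotProduct, dotProduct_sub, add_dotProduct, dotProduct_add, smul_dotProduct,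
    dotProduct_smul, smul_eq_mul, dotProduct_comm (Fin.init Z) u, hz] at hu ⊢
  have huu := dotProduct_self_nonneg u
  set z := Z (Fin.last (n + 1))
  set p := u ⬝ᵥ Fin.init Z
  set q := u ⬝ᵥ u
  have e1 : p + p / (1 + z) * (z ^ 2 - 1) = z * p := by field_simp; ring
  have e2 : 1 + (q + p / (1 + z) * p + p / (1 + z) * (p + p / (1 + z) * (z ^ 2 - 1))) =
      1 + q + p ^ 2 := by rw [e1]; field_simp; ring
  have hu' : z ^ 2 + z ^ 2 * q ≤ 2 * R * (z * p) + R ^ 2 := by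
    have e3 : z ^ 2 * (q - R / z * p - (R / z * p - R / z * (R / z * (z ^ 2 - 1)))) =
        z ^ 2 * q - 2 * R * (z * p) + R ^ 2 * (z ^ 2 - 1) := by field_simp; ring
    have := mul_le_mul_of_nonneg_left hu (sq_nonneg z)
    nlinarith
  have e4 : √(1 + (q + p / (1 + z) * p + p / (1 + z) * (p + p / (1 + z) * (z ^ 2 - 1)))) * z =
      √((1 + q + p ^ 2) * z ^ 2) := by
    rw [e2, Real.sqrt_mul (by positivity), Real.sqrt_sq h0.le]
  have key : √((1 + q + p ^ 2) * z ^ 2) ≤ z * p + R := by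
    apply Real.sqrt_le_iff.2
    refine ⟨?_, by nlinarith⟩
    by_contra! hneg
    have : 0 < z ^ 2 + z ^ 2 * q := by positivity
    nlinarith
  rw [e4, e1]
  linarith

lemma dotProduct_self_le_of_mem_closedBall {m : ℕ} {u c : Fin m → ℝ} {h : ℝ}
    (hu : u ∈ Metric.closedBall c h) : (u - c) ⬝ᵥ (u - c) ≤ m * h ^ 2 := by
  have : ∀ i ∈ Finset.univ, (u - c) i * (u - c) i ≤ h ^ 2 := fun i _ => by
    have h1 := (dist_le_pi_dist u c i).trans hu
    rw [Real.dist_eq] at h1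
    rw [← sq, ← sq_abs]
    exact pow_le_pow_left₀ (abs_nonneg _) h1 2
  exact (Finset.sum_le_sum this).trans (by simp)

/-- A set of finite coordinate volume containing a hyperbolic ball whose radius has hyperbolic
cosine `R` has volume bounded below in terms of `R`. -/
lemma le_hypVol (hn : 1 ≤ n) {K : Set (Fin (n + 2) → ℝ)} {Z : Fin (n + 2) → ℝ} (hZ : Z ∈ Hyp n)
    {R : ℝ} (hR1 : 1 ≤ R) (hR : (n + 1 : ℝ) ≤ 4 * (R ^ 2 - 1))
    (hK : ∀ W ∈ Hyp n, -lprod n W Z ≤ R → W ∈ K)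
    (hmeas : MeasurableSet (lift ⁻¹' K)) (hfin : volume (lift ⁻¹' K) ≠ ⊤) :
    2 * (R ^ 2 - 1) / ((n + 1) * R) ≤ hypVol n K := by
  have h0 := hZ.2
  have hR2 : 0 ≤ R ^ 2 - 1 := by nlinarith
  set h : ℝ := √((R ^ 2 - 1) / (n + 1)) with hh
  have hhsq : h ^ 2 = (R ^ 2 - 1) / (n + 1) := Real.sq_sqrt (by positivity)
  have hhpos : 0 ≤ h := Real.sqrt_nonneg _
  have hh1 : 1 ≤ 2 * h := by
    have : 1 ≤ (2 * h) ^ 2 := by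
      rw [mul_pow, hhsq, ← mul_div_assoc, one_le_div (by positivity)]
      linarith
    nlinarith
  set B := Metric.closedBall ((R / Z (Fin.last (n + 1))) • Fin.init Z) h with hB
  set E := boost n Z '' B with hE
  have hEW : ∀ x ∈ E, -lprod n (lift x) Z ≤ R := by
    rintro _ ⟨u, hu, rfl⟩
    refine neg_lprod_lift_boost_le hZ hR1 ((dotProduct_self_le_of_mem_closedBall hu).trans ?_)
    rw [hhsq]
    push_cast
    field_simp
    exact le_rfl
  have hsub : E ⊆ lift ⁻¹' K := fun x hx => hK _ (lift_mem_Hyp x) (hEW x hx)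
  have hEmeas : MeasurableSet E :=
    ((isCompact_closedBall _ _).image (boost n Z).continuous_of_finiteDimensional).measurableSet
  have hEvol : volume.real E = Z (Fin.last (n + 1)) * (2 * h) ^ (n + 1) := by
    rw [measureReal_def, hE, Measure.addHaar_image_linearMap, det_boost hZ, hB,
      Real.volume_pi_closedBall _ hhpos, Fintype.card_fin, ENNReal.toReal_mul,
      ENNReal.toReal_ofReal (abs_nonneg _), ENNReal.toReal_ofReal (by positivity), abs_of_pos h0]
  have hcont : Continuous fun y : Fin (n + 1) → ℝ => 1 / √(1 + ∑ i, y i ^ 2) :=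
    continuous_const.div (by fun_prop) fun y => by positivity
  have hint : IntegrableOn (fun y : Fin (n + 1) → ℝ => 1 / √(1 + ∑ i, y i ^ 2)) (lift ⁻¹' K) := by
    refine Measure.integrableOn_of_bounded (M := 1) hfin hcont.aestronglyMeasurable
      (Eventually.of_forall fun y => ?_)
    have h1 : 0 ≤ ∑ i, y i ^ 2 := Finset.sum_nonneg fun i _ => sq_nonneg _
    rw [Real.norm_of_nonneg (by positivity), div_le_one (by positivity), Real.one_le_sqrt]
    linarith
  have hvol : hypVol n K = ∫ y in lift ⁻¹' K, 1 / √(1 + ∑ i, y i ^ 2) :=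
    integral_indicator hmeas
  have hstep : ∫ _ in E, 1 / (2 * R * Z (Fin.last (n + 1))) ≤
      ∫ y in E, 1 / √(1 + ∑ i, y i ^ 2) := by
    refine setIntegral_mono_on (integrableOn_const ((measure_mono hsub).trans_lt
      hfin.lt_top).ne) (hint.mono_set hsub) hEmeas fun x hx => ?_
    have h1 := last_lt (lift_mem_Hyp x) hZ
    have h2 := hEW x hx
    have h3 := dotProduct_self_nonneg x
    rw [lift_last] at h1
    rw [sum_sq_eq_dotProduct]
    refine one_div_le_one_div_of_le (by positivity) (h1.le.trans ?_)
    gcongr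
  have hstep2 : ∫ y in E, 1 / √(1 + ∑ i, y i ^ 2) ≤
      ∫ y in lift ⁻¹' K, 1 / √(1 + ∑ i, y i ^ 2) :=
    setIntegral_mono_set hint (Eventually.of_forall fun y => by
      simp only [Pi.zero_apply]; positivity) hsub.eventuallyLE
  rw [hvol]
  refine le_trans ?_ (hstep.trans hstep2)
  rw [setIntegral_const, hEvol, smul_eq_mul]
  have hpow : (2 * h) ^ 2 ≤ (2 * h) ^ (n + 1) := pow_le_pow_right₀ hh1 (by omega)
  rw [mul_pow, hhsq] at hpow
  have e1 : Z (Fin.last (n + 1)) * (2 * h) ^ (n + 1) * (1 / (2 * R * Z (Fin.last (n + 1)))) =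
      (2 * h) ^ (n + 1) / (2 * R) := by field_simp
  have e2 : 2 * (R ^ 2 - 1) / ((n + 1) * R) = 2 ^ 2 * ((R ^ 2 - 1) / (n + 1)) / (2 * R) := by
    field_simp
  rw [e1, e2]
  gcongr

lemma tendsto_volBound (n : ℕ) :
    Tendsto (fun R : ℝ => 2 * (R ^ 2 - 1) / ((n + 1) * R)) atTop atTop := by
  have h1 : Tendsto (fun R : ℝ => 2 / (n + 1 : ℝ) * (R - 1)) atTop atTop :=
    (tendsto_atTop_add_const_right _ (-1) tendsto_id).const_mul_atTop (by positivity)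
  refine tendsto_atTop_mono' _ ?_ h1
  filter_upwards [eventually_ge_atTop 1] with R hR
  rw [div_mul_eq_mul_div, div_le_div_iff₀ (by positivity) (by positivity)]
  have : (0 : ℝ) < n + 1 := by positivity
  nlinarith [mul_nonneg this.le (sub_nonneg.2 hR)]

/-- All sets of finite coordinate volume containing a sufficiently large ball around some point
have volume exceeding `M`. -/
lemma exists_lt_hypVol (hn : 1 ≤ n) (M : ℝ) : ∃ R₀ : ℝ, ∀ R ≥ R₀,
    ∀ (K : Set (Fin (n + 2) → ℝ)), ∀ Z ∈ Hyp n, (∀ W ∈ Hyp n, -lprod n W Z ≤ R → W ∈ K) →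
      MeasurableSet (lift ⁻¹' K) → volume (lift ⁻¹' K) ≠ ⊤ → M < hypVol n K := by
  have h1 : ∀ᶠ R : ℝ in atTop, (n + 1 : ℝ) ≤ 4 * (R ^ 2 - 1) := by
    filter_upwards [eventually_ge_atTop (n + 2 : ℝ)] with R hR
    have : (0 : ℝ) ≤ n := by positivity
    nlinarith
  obtain ⟨R₀, hR₀⟩ := eventually_atTop.1
    ((eventually_ge_atTop 1).and (h1.and ((tendsto_volBound n).eventually_gt_atTop M)))
  refine ⟨R₀, fun R hR K Z hZ hK hm hf => ?_⟩
  obtain ⟨a, b, c⟩ := hR₀ R hR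
  exact c.trans_le (le_hypVol hn hZ a b hK hm hf)

lemma le_pairNorm {X Y : Fin (n + 2) → ℝ} {R : ℝ} (h : 8 * R ^ 2 ≤ -lprod n X Y) :
    R ≤ pairNorm n X Y / 4 := by
  have : 4 * R ≤ pairNorm n X Y := Real.le_sqrt_of_sq_le (by nlinarith)
  linarith

lemma dH_le_log {X Y : Fin (n + 2) → ℝ} (hX : X ∈ Hyp n) (hY : Y ∈ Hyp n) :
    dH n X Y ≤ Real.log (2 * -lprod n X Y) := by
  have h := lprod_le_neg_one hX hY
  have h1 : √(lprod n X Y ^ 2 - 1) ≤ -lprod n X Y :=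
    Real.sqrt_le_iff.2 ⟨by linarith, by nlinarith⟩
  exact Real.log_le_log (by linarith [Real.sqrt_nonneg (lprod n X Y ^ 2 - 1)]) (by linarith)

lemma horoSphere_subset {e : Fin (n + 1) → ℝ} (he : e ∈ sph n) {s : ℝ} :
    horoSphere n e s ⊆ horoBallCl n e s :=
  fun _ hX => (mem_horoBallCl_iff hX.1 he).2 hX.2.ge

lemma origin_mem_Hyp (n : ℕ) : origin n ∈ Hyp n := by
  constructor <;> simp [origin, lprod]

lemma lprod_origin (Y : Fin (n + 2) → ℝ) :
    lprod n (origin n) Y = -Y (Fin.last (n + 1)) := by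
  simp [origin, lprod]

lemma rpt_last (θ : Fin (n + 1) → ℝ) (r : ℝ) : rpt n θ r (Fin.last (n + 1)) = Real.cosh r := by
  simp [rpt]

lemma lprod_rpt (θ : Fin (n + 1) → ℝ) (r : ℝ) (Y : Fin (n + 2) → ℝ) :
    lprod n (rpt n θ r) Y =
      Real.sinh r * (θ ⬝ᵥ Fin.init Y) - Real.cosh r * Y (Fin.last (n + 1)) := by
  rw [rpt, lprod_snoc_left, ← smul_eq_mul (Real.sinh r), ← smul_dotProduct]
  rfl

lemma rpt_mem_Hyp {θ : Fin (n + 1) → ℝ} (hθ : θ ∈ sph n) (r : ℝ) : rpt n θ r ∈ Hyp n := by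
  have h1 : θ ⬝ᵥ θ = 1 := by rw [← sum_sq_eq_dotProduct]; exact hθ
  have h2 : Fin.init (rpt n θ r) = Real.sinh r • θ := by
    ext i
    simp [rpt, Fin.init]
  refine ⟨?_, by rw [rpt_last]; exact Real.cosh_pos r⟩
  rw [lprod_rpt, rpt_last, h2, dotProduct_smul, h1, smul_eq_mul]
  linarith [Real.cosh_sq r]

lemma isClosed_lift_preimage_hull (θ : Fin (n + 1) → ℝ) (r : ℝ) :
    IsClosed (lift ⁻¹' (⋂ (e ∈ sph n) (s : ℝ)
      (_ : origin n ∈ horoSphere n e s ∧ rpt n θ r ∈ horoSphere n e s), horoBallCl n e s)) := by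
  simp only [preimage_iInter]
  refine isClosed_iInter fun e => isClosed_iInter fun he => isClosed_iInter fun s =>
    isClosed_iInter fun _ => ?_
  have : lift ⁻¹' horoBallCl n e s = {x | -Real.exp s ≤ lprod n (lift x) (dir e)} := by
    ext x
    exact mem_horoBallCl_iff (lift_mem_Hyp x) he
  rw [this]
  exact isClosed_le continuous_const ((continuous_lprod_left _).comp continuous_lift)

lemma exists_orthogonal_unit (hn : 1 ≤ n) (θ : Fin (n + 1) → ℝ) :
    ∃ w : Fin (n + 1) → ℝ, w ⬝ᵥ w = 1 ∧ θ ⬝ᵥ w = 0 := by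
  suffices ∃ v : Fin (n + 1) → ℝ, v ≠ 0 ∧ θ ⬝ᵥ v = 0 by
    obtain ⟨v, hv, hθv⟩ := this
    have hpos : 0 < v ⬝ᵥ v := lt_of_le_of_ne (dotProduct_self_nonneg v)
      fun h => hv (dotProduct_self_eq_zero.1 h.symm)
    refine ⟨(√(v ⬝ᵥ v))⁻¹ • v, ?_, by rw [dotProduct_smul, hθv, smul_zero]⟩
    rw [dotProduct_smul, smul_dotProduct, smul_eq_mul, smul_eq_mul, ← mul_assoc, ← mul_inv,
      Real.mul_self_sqrt hpos.le, inv_mul_cancel₀ hpos.ne']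
  have hne : (0 : Fin (n + 1)) ≠ Fin.last n := by
    rw [Ne, Fin.ext_iff, Fin.val_zero, Fin.val_last]
    omega
  by_cases h : θ 0 = 0
  · exact ⟨Pi.single 0 1, by simp, by simp [h]⟩
  · refine ⟨Pi.single 0 (θ (Fin.last n)) - Pi.single (Fin.last n) (θ 0), fun h' => h ?_, ?_⟩
    · have := congrFun h' (Fin.last n)
      simpa [Pi.single_eq_of_ne hne.symm] using this
    · rw [dotProduct_sub, dotProduct_single, dotProduct_single]
      ring

lemma volume_lift_preimage_hull_ne_top (hn : 1 ≤ n) {θ : Fin (n + 1) → ℝ} (hθ : θ ∈ sph n)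
    {r : ℝ} (hr : 0 < r) :
    volume (lift ⁻¹' (⋂ (e ∈ sph n) (s : ℝ)
      (_ : origin n ∈ horoSphere n e s ∧ rpt n θ r ∈ horoSphere n e s), horoBallCl n e s)) ≠ ⊤ := by
  have hθ1 : θ ⬝ᵥ θ = 1 := by rw [← sum_sq_eq_dotProduct]; exact hθ
  have hs := Real.sinh_pos_iff.2 hr
  obtain ⟨w, hw, hθw⟩ := exists_orthogonal_unit hn θ
  set t : ℝ := (Real.cosh r - 1) / Real.sinh r with ht
  have ht0 : 0 ≤ t := div_nonneg (by linarith [Real.one_le_cosh r]) hs.le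
  have ht1 : t < 1 := by
    rw [ht, div_lt_one hs]
    have h1 := Real.cosh_sub_sinh r
    have h2 : Real.exp (-r) < 1 := by simpa using hr
    linarith
  have hst : Real.sinh r * t = Real.cosh r - 1 := by rw [ht]; field_simp
  have hbound : ∀ σ : ℝ, σ ^ 2 = 1 - t ^ 2 → ∀ x ∈ lift ⁻¹' (⋂ (e ∈ sph n) (s : ℝ)
      (_ : origin n ∈ horoSphere n e s ∧ rpt n θ r ∈ horoSphere n e s), horoBallCl n e s),
      √(1 + x ⬝ᵥ x) ≤ 1 + (t * (x ⬝ᵥ θ) + σ * (x ⬝ᵥ w)) := by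
    intro σ hσ x hx
    have he : t • θ + σ • w ∈ sph n := by
      change ∑ i, (t • θ + σ • w) i ^ 2 = 1
      rw [sum_sq_eq_dotProduct]
      simp only [add_dotProduct, dotProduct_add, smul_dotProduct, dotProduct_smul, smul_eq_mul,
        hθ1, hw, hθw, dotProduct_comm w θ]
      linarith
    simp only [mem_preimage, mem_iInter] at hx
    have hx' := (hx _ he 0 ⟨⟨origin_mem_Hyp n, ?_⟩, ⟨rpt_mem_Hyp hθ r, ?_⟩⟩).2.2
    · rw [lprod_eq, lift_last, init_lift, dir_last, dir, Fin.init_snoc, Real.exp_zero,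
        dotProduct_add, dotProduct_smul, dotProduct_smul, smul_eq_mul, smul_eq_mul] at hx'
      linarith
    · rw [lprod_origin, dir_last, Real.exp_zero]
    · rw [lprod_rpt, dir_last, dir, Fin.init_snoc, dotProduct_add, dotProduct_smul,
        dotProduct_smul, hθ1, hθw, Real.exp_zero, smul_eq_mul, smul_eq_mul]
      linarith
  refine (lt_of_le_of_lt (measure_mono fun x hx => ?_)
    (isCompact_closedBall (0 : Fin (n + 1) → ℝ) (1 / (1 - t))).measure_lt_top).ne
  have hσ : √(1 - t ^ 2) ^ 2 = 1 - t ^ 2 := Real.sq_sqrt (by nlinarith)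
  have h1 := hbound _ hσ x hx
  have h2 := hbound (-√(1 - t ^ 2)) (by rw [neg_sq, hσ]) x hx
  have hxx := dotProduct_self_nonneg x
  have h3 : x ⬝ᵥ θ ≤ √(1 + x ⬝ᵥ x) := by
    apply Real.le_sqrt_of_sq_le
    have := dotProduct_sq_le x θ
    rw [hθ1] at this
    linarith
  have h4 : √(1 + x ⬝ᵥ x) ≤ 1 / (1 - t) := by
    rw [le_div_iff₀ (by linarith)]
    nlinarith
  rw [mem_closedBall_zero_iff, pi_norm_le_iff_of_nonneg (by rw [one_div_nonneg]; linarith)]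
  intro i
  refine le_trans (Real.abs_le_sqrt ?_) h4
  have := Finset.single_le_sum (fun j _ => sq_nonneg (x j)) (Finset.mem_univ i)
  rw [sum_sq_eq_dotProduct] at this
  linarith

/-- The h-convex hull `T(r)` of `O` and the point `P_r` at distance `r` from `O` (the
intersection of all closed horo-balls whose boundary horosphere passes through both)
has volume tending to `+∞` as `r → ∞`. Consequently, for every `M > 0` there is `C > 0`
such that every h-convex body containing two points at distance at least `C` has
volume exceeding `M`. -/
theorem vol_hull_tendsto_atTop (n : ℕ) (hn : 1 ≤ n)
    (θ₀ : Fin (n + 1) → ℝ) (hθ₀ : θ₀ ∈ sph n) :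
    Tendsto (fun r : ℝ => hypVol n
        (⋂ (e ∈ sph n) (s : ℝ)
          (_ : origin n ∈ horoSphere n e s ∧ rpt n θ₀ r ∈ horoSphere n e s),
          horoBallCl n e s)) atTop atTop ∧
    ∀ M : ℝ, 0 < M → ∃ C : ℝ, 0 < C ∧ ∀ K : Set (Fin (n + 2) → ℝ),
      IsHConvexBody n K → (∃ X ∈ K, ∃ Y ∈ K, C ≤ dH n X Y) → M < hypVol n K := by
  constructor
  · refine tendsto_atTop.2 fun M => ?_
    obtain ⟨R₀, hR₀⟩ := exists_lt_hypVol hn M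
    filter_upwards [eventually_gt_atTop 0, eventually_ge_atTop (16 * R₀ ^ 2)] with r hr hr'
    have hO := origin_mem_Hyp n
    have hP := rpt_mem_Hyp hθ₀ r
    refine (hR₀ (pairNorm n (origin n) (rpt n θ₀ r) / 4) (le_pairNorm ?_) _ _ (midpt_mem_Hyp hO hP) (fun W hW hWZ => ?_)
      (isClosed_lift_preimage_hull θ₀ r).measurableSet
      (volume_lift_preimage_hull_ne_top hn hθ₀ hr)).le
    · rw [lprod_origin, rpt_last, neg_neg, Real.cosh_eq]
      linarith [Real.add_one_le_exp r, Real.exp_pos (-r)]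
    · simp only [mem_iInter]
      intro e he s hs
      exact (mem_horoBallCl_iff hW he).2 (lprod_dir_gt_of_near_midpt he
        (horoSphere_subset he hs.1) (horoSphere_subset he hs.2) hW hWZ).le
  · intro M _
    obtain ⟨R₀, hR₀⟩ := exists_lt_hypVol hn M
    refine ⟨|Real.log (16 * R₀ ^ 2)| + 1, by positivity, fun K hK ⟨X, hX, Y, hY, hXY⟩ => ?_⟩
    have hXH := hK.1.1 hX
    have hYH := hK.1.1 hY
    refine hR₀ (pairNorm n X Y / 4) (le_pairNorm ?_) K _ (midpt_mem_Hyp hXH hYH)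
      (fun W hW hWZ => ball_midpt_subset hK hX hY hW hWZ)
      (hK.1.2.1.preimage continuous_lift).measurableSet ?_
    · have h1 := lprod_le_neg_one hXH hYH
      by_contra! hlt
      have h2 : Real.log (2 * -lprod n X Y) ≤ Real.log (16 * R₀ ^ 2) :=
        Real.log_le_log (by linarith) (by linarith)
      linarith [dH_le_log hXH hYH, le_abs_self (Real.log (16 * R₀ ^ 2))]
    · have hcomp : IsCompact ((Fin.init : (Fin (n + 2) → ℝ) → Fin (n + 1) → ℝ) '' K) :=
        hK.2.1.image (by unfold Fin.init; fun_prop)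
      refine (lt_of_le_of_lt (measure_mono fun x hx => ?_) hcomp.measure_lt_top).ne
      exact ⟨lift x, hx, init_lift x⟩


end Horo
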